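/- Let A be a unital ring that is an associative algebra over ℝ, let j : ℍ → A be a unital ℝ-algebra homomorphism, let T ∈ A and q ∈ ℍ. Let P ∈ A satisfy P² = P, P·T = T·P and P·j(x) = j(x)·P for all x ∈ ℍ, and assume u := 𝒬_q(T)·(1 − P) + P is invertible in A. Define S_{L,B} := −u⁻¹·(T − j(q̄))·(1 − P) − P and S_{R,B} := −(T − j(q̄))·(1 − P)·u⁻¹ − P. Then S_{L,B}·j(q) − T·S_{L,B} − (T − j(q) − 1)·P = 1 and j(q)·S_{R,B} − S_{R,B}·T − (T − j(q) − 1)·P = 1. -/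

import Mathlib

/-- `𝒬_q(T) = T² − 2(Re q)•T + ‖q‖²•1` in an associative unital ℝ-algebra. -/
noncomputable def QopA {A : Type*} [Ring A] [Algebra ℝ A] (T : A) (q : Quaternion ℝ) : A :=
  T ^ 2 - (2 * q.re) • T + (‖q‖ ^ 2) • (1 : A)

theorem map_star_mul_map {A : Type*} [Ring A] [Algebra ℝ A] (j : Quaternion ℝ →ₐ[ℝ] A)
    (q : Quaternion ℝ) : j (star q) * j q = (‖q‖ ^ 2) • (1 : A) := by
  rw [← map_mul, Quaternion.star_mul_self, Quaternion.normSq_eq_norm_mul_self, ← pow_two,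
    ← Algebra.algebraMap_eq_smul_one]
  exact j.commutes _

theorem map_add_map_star {A : Type*} [Ring A] [Algebra ℝ A] (j : Quaternion ℝ →ₐ[ℝ] A)
    (q : Quaternion ℝ) : j q + j (star q) = (2 * q.re) • (1 : A) := by
  rw [← map_add, Quaternion.self_add_star, ← Algebra.algebraMap_eq_smul_one]
  have h : (2 * q.re : Quaternion ℝ) = algebraMap ℝ (Quaternion ℝ) (2 * q.re) := by
    rw [map_mul, map_ofNat]
    rfl
  rw [h, j.commutes]

theorem map_mul_map_star {A : Type*} [Ring A] [Algebra ℝ A] (j : Quaternion ℝ →ₐ[ℝ] A)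
    (q : Quaternion ℝ) : j q * j (star q) = (‖q‖ ^ 2) • (1 : A) := by
  simpa using map_star_mul_map j (star q)

theorem QopA_eq_left {A : Type*} [Ring A] [Algebra ℝ A] (j : Quaternion ℝ →ₐ[ℝ] A)
    (T : A) (q : Quaternion ℝ) :
    QopA T q = T * (T - j (star q)) - (T - j (star q)) * j q := by
  have h : (2 * q.re) • T = T * (j q + j (star q)) := by
    rw [map_add_map_star, mul_smul_comm, mul_one]
  rw [QopA, h, ← map_star_mul_map j]
  noncomm_ring

theorem QopA_eq_right {A : Type*} [Ring A] [Algebra ℝ A] (j : Quaternion ℝ →ₐ[ℝ] A)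
    (T : A) (q : Quaternion ℝ) :
    QopA T q = (T - j (star q)) * T - j q * (T - j (star q)) := by
  have h : (2 * q.re) • T = (j q + j (star q)) * T := by
    rw [map_add_map_star, smul_mul_assoc, one_mul]
  rw [QopA, h, ← map_mul_map_star j]
  noncomm_ring

theorem QopA_commute {A : Type*} [Ring A] [Algebra ℝ A] {T S : A} (h : Commute S T)
    (q : Quaternion ℝ) : Commute S (QopA T q) :=
  ((h.pow_right 2).sub_right (h.smul_right _)).add_right ((Commute.one_right S).smul_right _)

theorem stmt10 {A : Type*} [Ring A] [Algebra ℝ A]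
    (j : Quaternion ℝ →ₐ[ℝ] A) (T : A) (q : Quaternion ℝ) (P : A)
    (hP : P ^ 2 = P) (hPT : P * T = T * P) (hPj : ∀ x : Quaternion ℝ, P * j x = j x * P)
    (u : Aˣ) (hu : (u : A) = QopA T q * (1 - P) + P)
    (SL SR : A)
    (hSL : SL = -(((u⁻¹ : Aˣ) : A) * (T - j (star q)) * (1 - P)) - P)
    (hSR : SR = -((T - j (star q)) * (1 - P) * ((u⁻¹ : Aˣ) : A)) - P) :
    SL * j q - T * SL - (T - j q - 1) * P = 1 ∧
      j q * SR - SR * T - (T - j q - 1) * P = 1 := by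
  have hPP : P * P = P := by rw [← pow_two, hP]
  have hNT : Commute (1 - P) T := (Commute.one_left T).sub_left hPT
  have hNa : Commute (1 - P) (j q) := (Commute.one_left _).sub_left (hPj q)
  have hTu : Commute T (u : A) := by
    rw [hu]
    exact ((QopA_commute (Commute.refl T) q).mul_right hNT.symm).add_right hPT.symm
  have hTv : Commute T ((u⁻¹ : Aˣ) : A) := hTu.units_inv_right
  have hPN : P * (1 - P) = 0 := by rw [mul_sub, hPP, mul_one, sub_self]
  have hNP : (1 - P) * P = 0 := by rw [sub_mul, hPP, one_mul, sub_self]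
  have hNN : (1 - P) * (1 - P) = 1 - P := by rw [sub_mul, hPN, one_mul, sub_zero]
  have huN : (u : A) * (1 - P) = QopA T q * (1 - P) := by
    rw [hu, add_mul, mul_assoc, hNN, hPN, add_zero]
  have hNu : (1 - P) * (u : A) = QopA T q * (1 - P) := by
    rw [hu, mul_add, ← mul_assoc, (QopA_commute hNT q).eq, mul_assoc, hNN, hNP, add_zero]
  have hL : ((u⁻¹ : Aˣ) : A) * (QopA T q * (1 - P)) = 1 - P := by
    rw [← huN, Units.inv_mul_cancel_left]
  have hR : QopA T q * (1 - P) * ((u⁻¹ : Aˣ) : A) = 1 - P := by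
    rw [← hNu, Units.mul_inv_cancel_right]
  rw [QopA_eq_left j] at hL
  rw [QopA_eq_right j] at hR
  generalize ((u⁻¹ : Aˣ) : A) = v at *
  generalize T - j (star q) = D at *
  have hPa := hPj q
  constructor
  · calc SL * j q - T * SL - (T - j q - 1) * P
        = T * v * D * (1 - P) - v * D * ((1 - P) * j q) - P * j q + j q * P + P := by
          rw [hSL]; noncomm_ring
      _ = v * ((T * D - D * j q) * (1 - P)) + P := by
          rw [hTv.eq, hNa.eq, hPa]; noncomm_ring
      _ = 1 := by rw [hL, sub_add_cancel]
  · calc j q * SR - SR * T - (T - j q - 1) * P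
        = D * (1 - P) * (v * T) - j q * D * (1 - P) * v + P * T - T * P + P := by
          rw [hSR]; noncomm_ring
      _ = D * ((1 - P) * T) * v - j q * D * (1 - P) * v + P := by
          rw [← hTv.eq, hPT]; noncomm_ring
      _ = (D * T - j q * D) * (1 - P) * v + P := by
          rw [hNT.eq]; noncomm_ring
      _ = 1 := by rw [hR, sub_add_cancel]
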